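/- If weights are degree-monotone in a generating tuple ⟨μ,d⟩, then for any directed Huffman tree H ∈ ℛℋ(μ,d) the following holds: if vm and v′m′ are arcs of H with m ≠ m′ and f_H(v) < f_H(v′), then f_H(m) < f_H(m′). -/

import Mathlib

open scoped Classical
noncomputable section

/-- A directed tree on a finite vertex set `V`: each vertex has an outbound arc to its
`parent`, the `root` is a fixed point of `parent` (i.e. has no genuine outbound arc), and
every vertex reaches the root by iterating `parent`. -/
structure DirTree (V : Type) [Fintype V] [DecidableEq V] where
  root : V
  parent : V → V
  parent_root : parent root = root
  reaches : ∀ v, ∃ n, parent^[n] v = root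

variable {V : Type} [Fintype V] [DecidableEq V]

namespace DirTree

/-- `u` belongs to the subordinate group of `v`: there is a directed path from `u` to `v`. -/
def Desc (T : DirTree V) (u v : V) : Prop := ∃ n, T.parent^[n] u = v

/-- The set of vertices with an arc to `v`. -/
def children (T : DirTree V) (v : V) : Finset V :=
  Finset.univ.filter fun u => T.parent u = v ∧ u ≠ v

/-- Weight `f_T(v)` of the subordinate group of `v`. -/
def f (T : DirTree V) (μ : V → ℝ) (v : V) : ℝ :=
  ∑ u ∈ Finset.univ.filter (fun u => T.Desc u v), μ u

/-- Degree of `v` in the underlying undirected tree. -/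
def deg (T : DirTree V) (v : V) : ℕ :=
  (T.children v).card + (if v = T.root then 0 else 1)

/-- The underlying undirected tree. -/
def toGraph (T : DirTree V) : SimpleGraph V :=
  SimpleGraph.fromRel fun u v => T.parent u = v ∧ u ≠ v

/-- The vector (as a multiset, i.e. up to ascending rearrangement) of subordinate
groups' weights of internal non-root vertices. -/
def fvec (T : DirTree V) (μ : V → ℝ) : Multiset ℝ :=
  (Finset.univ.filter fun m => 1 < T.deg m ∧ m ≠ T.root).val.map (T.f μ)

end DirTree

/-- Degree of a vertex in a simple graph. -/
def gdeg (G : SimpleGraph V) (v : V) : ℕ :=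
  (Finset.univ.filter fun u => G.Adj v u).card

/-- `⟨μ, d⟩` is a generating tuple: nonnegative weights, degrees at least 1 summing to
`2(|V|-1)`, at least two pendent and at least one internal vertex. -/
structure IsGenTuple (μ : V → ℝ) (d : V → ℕ) : Prop where
  nonneg : ∀ v, 0 ≤ μ v
  deg_pos : ∀ v, 1 ≤ d v
  sum_deg : ∑ v, d v = 2 * (Fintype.card V - 1)
  two_le_pendent : 2 ≤ (Finset.univ.filter fun v => d v = 1).card
  one_le_internal : 1 ≤ (Finset.univ.filter fun v => 1 < d v).card

/-- Weights are degree-monotone in `⟨μ, d⟩`. -/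
def DegMonotone (μ : V → ℝ) (d : V → ℕ) : Prop :=
  (∀ m m', 1 < d m → 1 < d m' → d m < d m' → μ m ≤ μ m') ∧
  ∀ v, d v = 1 → 0 < μ v

/-- `T ∈ ℛ(μ,d)`: directed tree with internal root whose (undirected) degrees match `d`. -/
def memR (T : DirTree V) (d : V → ℕ) : Prop :=
  1 < d T.root ∧ ∀ v, T.deg v = d v

/-- `G ∈ 𝒯(μ,d)`: `G` is a tree whose degrees match `d`. -/
def memT (G : SimpleGraph V) (d : V → ℕ) : Prop :=
  G.IsTree ∧ ∀ v, gdeg G v = d v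

/-- Vertex-weighted Wiener index. -/
def VWWI (μ : V → ℝ) (G : SimpleGraph V) : ℝ :=
  (1 / 2) * ∑ u, ∑ v, μ u * μ v * (G.dist u v : ℝ)

/-- `S = (m, L)` is a minimal star for the state `(U, μ, d)`: the center `m` is an
internal vertex of `U` of least degree among internal vertices of least weight, and the
`d m - 1` leaves `L` are pendent vertices of `U` of least weights. -/
def IsMinimalStar (U : Finset V) (μ : V → ℝ) (d : V → ℕ) (m : V) (L : Finset V) : Prop :=
  m ∈ U ∧ 1 < d m ∧ L ⊆ U ∧ m ∉ L ∧ L.card = d m - 1 ∧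
  (∀ v ∈ L, d v = 1) ∧
  (∀ m' ∈ U, 1 < d m' → μ m ≤ μ m') ∧
  (∀ m' ∈ U, 1 < d m' → μ m' = μ m → d m ≤ d m') ∧
  ∀ u ∈ L, ∀ w ∈ U, d w = 1 → w ∉ L → μ u ≤ μ w

/-- Centers used before step `i` (0-indexed). -/
def usedCenters {q : ℕ} (c : Fin q → V) (i : ℕ) : Finset V :=
  (Finset.univ.filter fun j : Fin q => (j : ℕ) < i).image c

/-- Vertex set `V_{i+1}` of the state of the Huffman algorithm before (0-indexed) step `i`,
for the candidate Huffman tree `T` with star centers `c`. -/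
def stateV (T : DirTree V) {q : ℕ} (c : Fin q → V) (i : ℕ) : Finset V :=
  Finset.univ \ (Finset.univ.filter fun j : Fin q => (j : ℕ) < i).biUnion fun j => T.children (c j)

/-- Weight function `μ^{i+1}` of the state before (0-indexed) step `i`. -/
def stateMu (T : DirTree V) (μ : V → ℝ) {q : ℕ} (c : Fin q → V) (i : ℕ) : V → ℝ :=
  fun v => if v ∈ usedCenters c i then T.f μ v else μ v

/-- Degree function `d^{i+1}` of the state before (0-indexed) step `i`. -/
def stateD (d : V → ℕ) {q : ℕ} (c : Fin q → V) (i : ℕ) : V → ℕ :=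
  fun v => if v ∈ usedCenters c i then 1 else d v

/-- `T` is a directed Huffman tree for `⟨μ, d⟩` whose star sequence has centers
`c 0, …, c (q-1)` (so `S_i` has leaf set `children (c i)`): the centers enumerate the
internal vertices, the root is the last center, and at each of the first `q - 1` steps
the corresponding star is a minimal star of the current state. -/
def IsHuffmanSeq (μ : V → ℝ) (d : V → ℕ) (T : DirTree V) {q : ℕ} (c : Fin q → V) : Prop :=
  (∀ v, T.deg v = d v) ∧
  Function.Injective c ∧
  (∀ v, 1 < d v ↔ ∃ j, c j = v) ∧
  (∀ hq : 0 < q, T.root = c ⟨q - 1, Nat.sub_lt hq Nat.one_pos⟩) ∧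
  ∀ i : Fin q, (i : ℕ) < q - 1 →
    IsMinimalStar (stateV T c (i : ℕ)) (stateMu T μ c (i : ℕ)) (stateD d c (i : ℕ))
      (c i) (T.children (c i))

/-- `T ∈ ℛℋ(μ,d)`: `T` is a directed Huffman tree for `⟨μ, d⟩`. -/
def IsHuffmanDir (μ : V → ℝ) (d : V → ℕ) (T : DirTree V) : Prop :=
  ∃ (q : ℕ) (c : Fin q → V), IsHuffmanSeq μ d T c

/-- Sum of the `k` smallest components of a multiset of reals. -/
def ascSum (s : Multiset ℝ) (k : ℕ) : ℝ := ((s.sort (· ≤ ·)).take k).sum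

/-- `x` weakly majorizes `y` (`y ⪯^w x`). -/
def WMaj (x y : Multiset ℝ) : Prop :=
  Multiset.card x = Multiset.card y ∧ ∀ k, ascSum x k ≤ ascSum y k

/-- `x` strictly weakly majorizes `y` (`y ≺^w x`). -/
def SWMaj (x y : Multiset ℝ) : Prop := WMaj x y ∧ x ≠ y

namespace DirTree

variable (T : DirTree V)

lemma iterate_parent_root (n : ℕ) : T.parent^[n] T.root = T.root :=
  Function.iterate_fixed T.parent_root n

lemma eq_root_of_iterate_eq_self {x : V} {n : ℕ} (h : T.parent^[n + 1] x = x) :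
    x = T.root := by
  obtain ⟨N, hN⟩ := T.reaches x
  have h1 : T.parent^[(n + 1) * N] x = x := by
    rw [Function.iterate_mul]
    exact Function.iterate_fixed h N
  have h2 : (n + 1) * N = n * N + N := by ring
  rw [h2, Function.iterate_add_apply, hN, T.iterate_parent_root] at h1
  exact h1.symm

lemma mem_children {u v : V} : u ∈ T.children v ↔ T.parent u = v ∧ u ≠ v := by
  simp [children]

lemma ne_root_of_mem_children {u v : V} (h : u ∈ T.children v) : u ≠ T.root := by
  rw [mem_children] at h
  rintro rfl
  exact h.2 (T.parent_root.symm.trans h.1)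

lemma mem_children_parent {v : V} (h : v ≠ T.root) : v ∈ T.children (T.parent v) :=
  T.mem_children.2 ⟨rfl, fun hv => h (T.eq_root_of_iterate_eq_self (n := 0) hv.symm)⟩

lemma not_desc_child {u v : V} (h : u ∈ T.children v) : ¬ T.Desc v u := by
  rintro ⟨n, hn⟩
  have hu := T.ne_root_of_mem_children h
  have hv : v = T.root := by
    apply T.eq_root_of_iterate_eq_self (n := n)
    rw [Function.iterate_succ_apply', hn, (T.mem_children.1 h).1]
  rw [hv, T.iterate_parent_root] at hn
  exact hu hn.symm

lemma eq_of_mem_children_of_desc {u v a b : V} (ha : a ∈ T.children v)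
    (hb : b ∈ T.children v) (hua : T.Desc u a) (hub : T.Desc u b) : a = b := by
  obtain ⟨n, hn⟩ := hua
  obtain ⟨k, hk⟩ := hub
  wlog hle : n ≤ k generalizing a b n k
  · exact (this hb ha k hk n hn (by omega)).symm
  obtain ⟨e, rfl⟩ := Nat.exists_eq_add_of_le' hle
  rw [Function.iterate_add_apply, hn] at hk
  rcases e with _ | e
  · exact hk
  · rw [Function.iterate_succ_apply, (T.mem_children.1 ha).1] at hk
    exact absurd ⟨e, hk⟩ (T.not_desc_child hb)

lemma desc_iff {u v : V} : T.Desc u v ↔ u = v ∨ ∃ a ∈ T.children v, T.Desc u a := by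
  constructor
  · rintro ⟨n, hn⟩
    induction n with
    | zero => exact Or.inl hn
    | succ n ih =>
      by_cases h : T.parent^[n] u = v
      · exact ih h
      · refine Or.inr ⟨_, T.mem_children.2 ⟨?_, h⟩, n, rfl⟩
        rwa [Function.iterate_succ_apply'] at hn
  · rintro (rfl | ⟨a, ha, n, hn⟩)
    · exact ⟨0, rfl⟩
    · refine ⟨n + 1, ?_⟩
      rw [Function.iterate_succ_apply', hn, (T.mem_children.1 ha).1]

/-- The weight of a subordinate group splits over the children of its top vertex. -/
lemma f_eq_add_sum_children (μ : V → ℝ) (v : V) :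
    T.f μ v = μ v + ∑ u ∈ T.children v, T.f μ u := by
  have hset : (Finset.univ.filter fun u => T.Desc u v) =
      insert v ((T.children v).biUnion fun a => Finset.univ.filter fun u => T.Desc u a) := by
    ext u
    simp [T.desc_iff (u := u) (v := v)]
  have hv : v ∉ (T.children v).biUnion fun a => Finset.univ.filter fun u => T.Desc u a := by
    simp only [Finset.mem_biUnion, Finset.mem_filter, Finset.mem_univ, true_and, not_exists,
      not_and]
    exact fun a ha => T.not_desc_child ha
  unfold f
  rw [hset, Finset.sum_insert hv, Finset.sum_biUnion]
  intro a ha b hb hab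
  refine Finset.disjoint_left.2 fun u hu hu' => hab ?_
  simp only [Finset.mem_filter, Finset.mem_univ, true_and] at hu hu'
  exact T.eq_of_mem_children_of_desc ha hb hu hu'

lemma f_nonneg {μ : V → ℝ} (hμ : ∀ v, 0 ≤ μ v) (v : V) : 0 ≤ T.f μ v :=
  Finset.sum_nonneg fun u _ => hμ u

lemma f_le_of_mem_children {μ : V → ℝ} (hμ : ∀ v, 0 ≤ μ v) {u v : V}
    (h : u ∈ T.children v) : T.f μ u ≤ T.f μ v := by
  rw [T.f_eq_add_sum_children μ v]
  have := Finset.single_le_sum (f := T.f μ) (fun a _ => T.f_nonneg hμ a) h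
  linarith [hμ v]

end DirTree

lemma sum_le_sum_of_forall_le {ι : Type*} {A B : Finset ι} {g : ι → ℝ}
    (hg : ∀ x, 0 ≤ g x) (hcard : A.card ≤ B.card) (hle : ∀ a ∈ A, ∀ b ∈ B, g a ≤ g b) :
    ∑ a ∈ A, g a ≤ ∑ b ∈ B, g b := by
  rcases A.eq_empty_or_nonempty with rfl | hA
  · simpa using Finset.sum_nonneg fun b _ => hg b
  · obtain ⟨a, ha, hmax⟩ := A.exists_max_image g hA
    calc ∑ x ∈ A, g x ≤ A.card • g a := Finset.sum_le_card_nsmul _ _ _ hmax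
      _ ≤ B.card • g a := nsmul_le_nsmul_left (hg a) hcard
      _ ≤ ∑ b ∈ B, g b := Finset.card_nsmul_le_sum _ _ _ fun b hb => hle a ha b hb

lemma sum_lt_sum_of_forall_le {ι : Type*} {A B : Finset ι} {g : ι → ℝ}
    (hg : ∀ x, 0 ≤ g x) (hcard : A.card ≤ B.card) (hle : ∀ a ∈ A, ∀ b ∈ B, g a ≤ g b)
    {a b : ι} (ha : a ∈ A) (hb : b ∈ B) (hab : g a < g b) :
    ∑ x ∈ A, g x < ∑ x ∈ B, g x := by
  rw [← Finset.add_sum_erase A g ha, ← Finset.add_sum_erase B g hb]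
  refine add_lt_add_of_lt_of_le hab (sum_le_sum_of_forall_le hg ?_ fun x hx y hy =>
    hle x (Finset.mem_of_mem_erase hx) y (Finset.mem_of_mem_erase hy))
  rw [Finset.card_erase_of_mem ha, Finset.card_erase_of_mem hb]
  omega

lemma mem_usedCenters {W : Type} [DecidableEq W] {q : ℕ} {c : Fin q → W} {i : ℕ} {v : W} :
    v ∈ usedCenters c i ↔ ∃ k : Fin q, (k : ℕ) < i ∧ c k = v := by
  simp [usedCenters]

namespace IsHuffmanSeq

variable {μ : V → ℝ} {d : V → ℕ} {T : DirTree V} {q : ℕ} {c : Fin q → V}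

lemma isMinimalStar_of_lt (h : IsHuffmanSeq μ d T c) {i j : Fin q} (hij : i < j) :
    IsMinimalStar (stateV T c (i : ℕ)) (stateMu T μ c (i : ℕ)) (stateD d c (i : ℕ))
      (c i) (T.children (c i)) :=
  h.2.2.2.2 i (by have := j.2; have : (i : ℕ) < j := hij; omega)

lemma center_notMem_usedCenters (h : IsHuffmanSeq μ d T c) {i j : Fin q} (hij : i ≤ j) :
    c j ∉ usedCenters c (i : ℕ) := by
  rw [mem_usedCenters]
  rintro ⟨k, hk, hkj⟩
  rw [h.2.1 hkj] at hk
  exact absurd hk (not_lt.2 hij)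

lemma one_lt_deg (h : IsHuffmanSeq μ d T c) (j : Fin q) : 1 < d (c j) :=
  (h.2.2.1 _).2 ⟨j, rfl⟩

lemma root_eq (h : IsHuffmanSeq μ d T c) (j : Fin q) :
    T.root = c ⟨q - 1, Nat.sub_lt (Fin.pos j) Nat.one_pos⟩ :=
  h.2.2.2.1 (Fin.pos j)

/-- A child which is itself a center is used before its parent. -/
lemma lt_of_center_mem_children (h : IsHuffmanSeq μ d T c) {k j : Fin q}
    (hk : c k ∈ T.children (c j)) : k < j := by
  have hkr : c k ≠ T.root := T.ne_root_of_mem_children hk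
  by_cases hj : (j : ℕ) < q - 1
  · have hd := (h.2.2.2.2 j hj).2.2.2.2.2.1 _ hk
    by_contra hjk
    have hn := h.center_notMem_usedCenters (not_lt.1 hjk)
    simp only [stateD, if_neg hn] at hd
    exact absurd (h.one_lt_deg k) (by omega)
  · have hne : (k : ℕ) ≠ q - 1 := by
      intro hkq
      apply hkr
      rw [h.root_eq j]
      exact congrArg c (Fin.ext hkq)
    have := k.2
    exact Fin.lt_def.2 (by omega)

lemma mem_stateV_of_le (h : IsHuffmanSeq μ d T c) {i j : Fin q} (hij : i ≤ j) {w : V}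
    (hw : w ∈ T.children (c j)) : w ∈ stateV T c (i : ℕ) := by
  simp only [stateV, Finset.mem_sdiff, Finset.mem_univ, true_and, Finset.mem_biUnion,
    Finset.mem_filter, not_exists, not_and]
  intro k hk hwk
  have hkj : c k = c j := (T.mem_children.1 hwk).1.symm.trans (T.mem_children.1 hw).1
  rw [h.2.1 hkj] at hk
  exact absurd hk (not_lt.2 hij)

lemma center_mem_stateV (h : IsHuffmanSeq μ d T c) {i j : Fin q} (hij : i ≤ j) :
    c j ∈ stateV T c (i : ℕ) := by
  simp only [stateV, Finset.mem_sdiff, Finset.mem_univ, true_and, Finset.mem_biUnion,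
    Finset.mem_filter, not_exists, not_and]
  intro k hk hjk
  exact absurd ((h.lt_of_center_mem_children hjk).trans (Fin.lt_def.2 hk)) (not_lt.2 hij)

/-- A pendent vertex of the state at step `i` is weighted by its subordinate group. -/
lemma stateMu_eq_f (h : IsHuffmanSeq μ d T c) {i : Fin q} {w : V}
    (hw : stateD d c (i : ℕ) w = 1) : stateMu T μ c (i : ℕ) w = T.f μ w := by
  unfold stateMu
  split_ifs with hu
  · rfl
  · simp only [stateD, if_neg hu] at hw
    have hr : w ≠ T.root := by
      rintro rfl
      rw [h.root_eq i] at hw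
      exact absurd (h.one_lt_deg _) (by rw [hw]; omega)
    have hdeg := h.1 w
    rw [DirTree.deg, if_neg hr, hw] at hdeg
    have hc : T.children w = ∅ := Finset.card_eq_zero.1 (by omega)
    rw [T.f_eq_add_sum_children, hc, Finset.sum_empty, add_zero]

/-- A child of a later center is pendent at step `i` unless it is a center not yet used. -/
lemma stateD_eq_one_or (h : IsHuffmanSeq μ d T c) (hpos : ∀ v, 1 ≤ d v) (i : Fin q) (w : V) :
    stateD d c (i : ℕ) w = 1 ∨ ∃ k, i ≤ k ∧ c k = w := by
  unfold stateD
  split_ifs with hu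
  · exact Or.inl rfl
  · rcases (hpos w).eq_or_lt with h1 | h1
    · exact Or.inl h1.symm
    · obtain ⟨k, hk⟩ := (h.2.2.1 w).1 h1
      refine Or.inr ⟨k, not_lt.1 fun hki => hu (mem_usedCenters.2 ⟨k, hki, hk⟩), hk⟩

lemma f_le_of_mem_children_of_lt (h : IsHuffmanSeq μ d T c) (hgen : IsGenTuple μ d)
    {i j : Fin q} (hij : i < j)
    (hmon : ∀ k, i ≤ k → k < j → T.f μ (c i) ≤ T.f μ (c k))
    {u w : V} (hu : u ∈ T.children (c i)) (hw : w ∈ T.children (c j)) :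
    T.f μ u ≤ T.f μ w := by
  have hstar := h.isMinimalStar_of_lt hij
  rcases h.stateD_eq_one_or hgen.deg_pos i w with h1 | ⟨k, hik, rfl⟩
  · have hwi : w ∉ T.children (c i) := fun hwi => hij.ne (h.2.1
      ((T.mem_children.1 hwi).1.symm.trans (T.mem_children.1 hw).1))
    have := hstar.2.2.2.2.2.2.2.2 u hu w (h.mem_stateV_of_le hij.le hw) h1 hwi
    rwa [h.stateMu_eq_f (hstar.2.2.2.2.2.1 u hu), h.stateMu_eq_f h1] at this
  · exact (T.f_le_of_mem_children hgen.nonneg hu).trans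
      (hmon k hik (h.lt_of_center_mem_children hw))

lemma weight_le_and_degree_le (h : IsHuffmanSeq μ d T c) (hmono : DegMonotone μ d)
    {i j : Fin q} (hij : i < j) : μ (c i) ≤ μ (c j) ∧ d (c i) ≤ d (c j) := by
  have hstar := h.isMinimalStar_of_lt hij
  have hi := h.center_notMem_usedCenters (le_refl i)
  have hj := h.center_notMem_usedCenters hij.le
  have hU := h.center_mem_stateV hij.le
  have hd : 1 < stateD d c (i : ℕ) (c j) := by
    simpa only [stateD, if_neg hj] using h.one_lt_deg j
  have hle := hstar.2.2.2.2.2.2.1 _ hU hd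
  have hdle := hstar.2.2.2.2.2.2.2.1 _ hU hd
  simp only [stateMu, stateD, if_neg hi, if_neg hj] at hle hdle
  refine ⟨hle, not_lt.1 fun hlt => ?_⟩
  have := hmono.1 _ _ (h.one_lt_deg j) (h.one_lt_deg i) hlt
  exact absurd (hdle (le_antisymm this hle)) (not_le.2 hlt)

lemma card_children_le (h : IsHuffmanSeq μ d T c) (hmono : DegMonotone μ d)
    {i j : Fin q} (hij : i < j) : (T.children (c i)).card ≤ (T.children (c j)).card := by
  have hd := (h.weight_le_and_degree_le hmono hij).2
  have hi : c i ≠ T.root := by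
    rw [h.root_eq i]
    intro hi
    have hiq : (i : ℕ) = q - 1 := congrArg Fin.val (h.2.1 hi)
    have hij' : (i : ℕ) < j := hij
    have := j.2
    omega
  rw [← h.1, ← h.1, DirTree.deg, DirTree.deg, if_neg hi] at hd
  split_ifs at hd <;> omega

/-- Subordinate groups' weights of the centers are nondecreasing along the star sequence. -/
lemma f_center_mono (h : IsHuffmanSeq μ d T c) (hgen : IsGenTuple μ d)
    (hmono : DegMonotone μ d) {i j : Fin q} (hij : i ≤ j) :
    T.f μ (c i) ≤ T.f μ (c j) := by
  induction j using WellFoundedLT.induction with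
  | _ j ih =>
    rcases hij.eq_or_lt with rfl | hlt
    · exact le_rfl
    · rw [T.f_eq_add_sum_children μ (c i), T.f_eq_add_sum_children μ (c j)]
      exact add_le_add (h.weight_le_and_degree_le hmono hlt).1
        (sum_le_sum_of_forall_le (T.f_nonneg hgen.nonneg) (h.card_children_le hmono hlt)
          fun u hu w hw => h.f_le_of_mem_children_of_lt hgen hlt
            (fun k hik hkj => ih k hkj hik) hu hw)

lemma exists_center_eq (h : IsHuffmanSeq μ d T c) (hgen : IsGenTuple μ d) {u v : V}
    (hu : u ∈ T.children v) : ∃ j, c j = v := by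
  by_cases hv : v = T.root
  · obtain ⟨x, hx⟩ := Finset.card_pos.1 hgen.one_le_internal
    obtain ⟨j, -⟩ := (h.2.2.1 x).1 (Finset.mem_filter.1 hx).2
    exact ⟨_, (h.root_eq j).symm.trans hv.symm⟩
  · rw [← h.2.2.1, ← h.1, DirTree.deg, if_neg hv]
    have := Finset.card_pos.2 ⟨u, hu⟩
    omega

end IsHuffmanSeq

/-- in a directed Huffman tree for a degree-monotone tuple, if `vm` and
`v'm'` are arcs with `m ≠ m'` and `f_H(v) < f_H(v')`, then `f_H(m) < f_H(m')`. -/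
theorem huffman_parents_monotone {V : Type} [Fintype V] [DecidableEq V]
    (μ : V → ℝ) (d : V → ℕ) (hgen : IsGenTuple μ d) (hmono : DegMonotone μ d)
    (H : DirTree V) (hH : IsHuffmanDir μ d H)
    (v v' m m' : V)
    (harc : H.parent v = m) (hvroot : v ≠ H.root)
    (harc' : H.parent v' = m') (hv'root : v' ≠ H.root)
    (hmm : m ≠ m') (hf : H.f μ v < H.f μ v') :
    H.f μ m < H.f μ m' := by
  obtain ⟨q, c, h⟩ := hH
  have hv : v ∈ H.children m := harc ▸ H.mem_children_parent hvroot
  have hv' : v' ∈ H.children m' := harc' ▸ H.mem_children_parent hv'root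
  obtain ⟨i, rfl⟩ := h.exists_center_eq hgen hv
  obtain ⟨j, rfl⟩ := h.exists_center_eq hgen hv'
  have hle : ∀ {i j : Fin q}, i < j → ∀ u ∈ H.children (c i), ∀ w ∈ H.children (c j),
      H.f μ u ≤ H.f μ w := fun hij u hu w hw =>
    h.f_le_of_mem_children_of_lt hgen hij (fun k hik _ => h.f_center_mono hgen hmono hik) hu hw
  rcases lt_trichotomy i j with hij | rfl | hji
  · rw [H.f_eq_add_sum_children μ (c i), H.f_eq_add_sum_children μ (c j)]
    exact add_lt_add_of_le_of_lt (h.weight_le_and_degree_le hmono hij).1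
      (sum_lt_sum_of_forall_le (H.f_nonneg hgen.nonneg) (h.card_children_le hmono hij)
        (hle hij) hv hv' hf)
  · exact absurd rfl hmm
  · exact absurd (hle hji v' hv' v hv) (not_le.2 hf)
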